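/- arXiv:2307.16826 — 2 statements merged into one kernel-verified Lean document; each statement's English description precedes it below -/
import Mathlib

section
/- Let C be a Noetherian collection of subsets of a set X. If Y ⊆ X is constructible and nonempty, then Rirr(closure(Y) \ Y) < Rirr(Y), where closure denotes T_C-closure. -/
/-- A family of subsets satisfies the descending chain condition if every
decreasing chain of members eventually stabilises. -/
def FamilyDCC {X : Type*} (C : Set (Set X)) : Prop :=
  ∀ f : ℕ → Set X, (∀ n, f n ∈ C) → (∀ n, f (n + 1) ⊆ f n) →
    ∃ n₀, ∀ n, n₀ ≤ n → f n = f n₀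

/-- A collection of subsets of `X` is Noetherian if it contains `X`, is closed
under finite (binary) intersections and satisfies the descending chain condition. -/
def NoetherianFamily {X : Type*} (C : Set (Set X)) : Prop :=
  Set.univ ∈ C ∧ (∀ A ∈ C, ∀ B ∈ C, A ∩ B ∈ C) ∧ FamilyDCC C

/-- The closed sets of the topology `T_C` are the finite unions of members of `C`. -/
def IsClosedIn {X : Type*} (C : Set (Set X)) (A : Set X) : Prop :=
  ∃ S : Finset (Set X), ↑S ⊆ C ∧ A = ⋃₀ ↑S

/-- A set is `T_C`-open if its complement is `T_C`-closed. -/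
def IsOpenIn {X : Type*} (C : Set (Set X)) (O : Set X) : Prop :=
  IsClosedIn C Oᶜ

/-- The `T_C`-closure of a subset: the intersection of all closed sets containing it. -/
def closureIn {X : Type*} (C : Set (Set X)) (Y : Set X) : Set X :=
  ⋂₀ {A | IsClosedIn C A ∧ Y ⊆ A}

/-- A member `A` of `C` is irreducible if it is nonempty and cannot be written as a
finite union of proper subsets belonging to `C`. -/
def IrredIn {X : Type*} (C : Set (Set X)) (A : Set X) : Prop :=
  A ∈ C ∧ A.Nonempty ∧
    ∀ S : Finset (Set X), ↑S ⊆ C → (∀ B ∈ S, B ⊂ A) → A ≠ ⋃₀ ↑S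

/-- The foundational rank `Rirr` of an irreducible member of `C` with respect to strict
inclusion among irreducible members of `C` (the descending chain condition makes this
relation well-founded; outside of that situation the value is junk). -/
noncomputable def rirrOrd {X : Type*} (C : Set (Set X)) (A : Set X) : Ordinal :=
  open Classical in
  if h : WellFounded (fun B B' : Set X => IrredIn C B ∧ IrredIn C B' ∧ B ⊂ B')
  then (h.apply A).rank else 0

open Classical in
/-- The rank `Rirr` of an arbitrary subset `Y` of `X`: the maximum of the ranks of the
irreducible members of `C` contained in the `T_C`-closure of `Y` (equivalently, of the
irreducible components of the closure), and `⊥` (i.e. `-∞`) if there are none, which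
for a Noetherian collection happens exactly when `Y` is empty. -/
noncomputable def rirr {X : Type*} (C : Set (Set X)) (Y : Set X) : WithBot Ordinal :=
  if ∃ B, IrredIn C B ∧ B ⊆ closureIn C Y then
    ↑(sSup {o : Ordinal | ∃ B, IrredIn C B ∧ B ⊆ closureIn C Y ∧ o = rirrOrd C B})
  else ⊥

/-- The degree of a subset `Y` of `X`: the number of irreducible members of `C`
contained in the `T_C`-closure of `Y` whose rank equals `Rirr(Y)`. -/
noncomputable def degC {X : Type*} (C : Set (Set X)) (Y : Set X) : ℕ :=
  Set.ncard {B | IrredIn C B ∧ B ⊆ closureIn C Y ∧ (rirrOrd C B : WithBot Ordinal) = rirr C Y}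

/-- Constructible subsets: finite Boolean combinations of `T_C`-closed sets. -/
inductive ConstructibleIn {X : Type*} (C : Set (Set X)) : Set X → Prop
  | of_closed : ∀ A, IsClosedIn C A → ConstructibleIn C A
  | compl : ∀ A, ConstructibleIn C A → ConstructibleIn C Aᶜ
  | union : ∀ A B, ConstructibleIn C A → ConstructibleIn C B → ConstructibleIn C (A ∪ B)

theorem NoetherianFamily.wellFounded_ssubset {X : Type*} {C : Set (Set X)}
    (hC : NoetherianFamily C) :
    WellFounded (fun A B : Set X => A ∈ C ∧ B ∈ C ∧ A ⊂ B) := by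
  rw [wellFounded_iff_isEmpty_descending_chain]
  refine ⟨fun ⟨f, hf⟩ => ?_⟩
  obtain ⟨n, hn⟩ := hC.2.2 f (fun n => (hf n).2.1) (fun n => (hf n).2.2.subset)
  exact (hf n).2.2.ne (hn (n + 1) (Nat.le_succ n))

theorem NoetherianFamily.wellFounded_irred {X : Type*} {C : Set (Set X)}
    (hC : NoetherianFamily C) :
    WellFounded (fun A B : Set X => IrredIn C A ∧ IrredIn C B ∧ A ⊂ B) :=
  Subrelation.wf (fun h => ⟨h.1.1, h.2.1.1, h.2.2⟩) hC.wellFounded_ssubset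

theorem isClosedIn_empty {X : Type*} (C : Set (Set X)) : IsClosedIn C ∅ :=
  ⟨∅, by simp, by simp⟩

theorem isClosedIn_of_mem {X : Type*} {C : Set (Set X)} {A : Set X} (hA : A ∈ C) :
    IsClosedIn C A :=
  ⟨{A}, by simpa using hA, by simp⟩

theorem IsClosedIn.union {X : Type*} {C : Set (Set X)} {A B : Set X}
    (hA : IsClosedIn C A) (hB : IsClosedIn C B) : IsClosedIn C (A ∪ B) := by
  classical
  obtain ⟨S, hS, rfl⟩ := hA
  obtain ⟨T, hT, rfl⟩ := hB
  exact ⟨S ∪ T, by simp [hS, hT], by rw [Finset.coe_union, Set.sUnion_union]⟩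

theorem IsClosedIn.biUnion_finset {X ι : Type*} {C : Set (Set X)} (S : Finset ι) (f : ι → Set X)
    (h : ∀ i ∈ S, IsClosedIn C (f i)) : IsClosedIn C (⋃ i ∈ S, f i) := by
  classical
  induction S using Finset.induction_on with
  | empty => simpa using isClosedIn_empty C
  | insert a S _ ih =>
    rw [Finset.set_biUnion_insert]
    exact (h a (Finset.mem_insert_self a S)).union
      (ih fun i hi => h i (Finset.mem_insert_of_mem hi))

theorem NoetherianFamily.isClosedIn_inter_sInter {X : Type*} {C : Set (Set X)}
    (hC : NoetherianFamily C) (F : Set (Set X)) (hF : ∀ A ∈ F, IsClosedIn C A)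
    {A : Set X} (hA : A ∈ C) : IsClosedIn C (A ∩ ⋂₀ F) := by
  induction A using hC.wellFounded_ssubset.induction with
  | _ A ih =>
    by_cases h : ∀ B ∈ F, A ⊆ B
    · rw [Set.inter_eq_left.2 (Set.subset_sInter h)]
      exact isClosedIn_of_mem hA
    · push Not at h
      obtain ⟨B, hBF, hAB⟩ := h
      obtain ⟨S, hS, hBS⟩ := hF B hBF
      have key : A ∩ ⋂₀ F = ⋃ D ∈ S, (A ∩ D) ∩ ⋂₀ F := by
        ext x
        simp only [Set.mem_iUnion, Set.mem_inter_iff, exists_prop]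
        constructor
        · rintro ⟨hxA, hxF⟩
          have hxB : x ∈ B := hxF B hBF
          rw [hBS] at hxB
          obtain ⟨D, hD, hxD⟩ := hxB
          exact ⟨D, hD, ⟨hxA, hxD⟩, hxF⟩
        · rintro ⟨D, -, ⟨hxA, -⟩, hxF⟩
          exact ⟨hxA, hxF⟩
      rw [key]
      refine IsClosedIn.biUnion_finset S _ fun D hD => ?_
      have hAD : A ∩ D ∈ C := hC.2.1 A hA D (hS hD)
      refine ih _ ⟨hAD, hA, Set.inter_subset_left, fun hsub => hAB fun x hx => ?_⟩ hAD
      rw [hBS]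
      exact ⟨D, hD, (hsub hx).2⟩

theorem NoetherianFamily.isClosedIn_closureIn {X : Type*} {C : Set (Set X)}
    (hC : NoetherianFamily C) (Y : Set X) : IsClosedIn C (closureIn C Y) := by
  have h := hC.isClosedIn_inter_sInter {A | IsClosedIn C A ∧ Y ⊆ A} (fun A hA => hA.1) hC.1
  rwa [Set.univ_inter] at h

theorem subset_closureIn {X : Type*} (C : Set (Set X)) (Y : Set X) : Y ⊆ closureIn C Y :=
  Set.subset_sInter fun _ hA => hA.2

theorem closureIn_subset {X : Type*} {C : Set (Set X)} {Y A : Set X}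
    (hA : IsClosedIn C A) (h : Y ⊆ A) : closureIn C Y ⊆ A :=
  Set.sInter_subset_of_mem ⟨hA, h⟩

/-- Every closed set is a finite union of irreducible members. -/
theorem NoetherianFamily.exists_irred_decomposition {X : Type*} {C : Set (Set X)}
    (hC : NoetherianFamily C) {A : Set X} (hA : IsClosedIn C A) :
    ∃ S : Finset (Set X), (∀ B ∈ S, IrredIn C B) ∧ A = ⋃₀ ↑S := by
  suffices h : ∀ A ∈ C, IsClosedIn {B | IrredIn C B} A by
    obtain ⟨S, hS, rfl⟩ := hA
    rw [Set.sUnion_eq_biUnion]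
    exact IsClosedIn.biUnion_finset S _ fun B hB => h B (hS hB)
  intro A hA
  induction A using hC.wellFounded_ssubset.induction with
  | _ A ih =>
    by_cases hirr : IrredIn C A
    · exact isClosedIn_of_mem (C := {B | IrredIn C B}) hirr
    rcases A.eq_empty_or_nonempty with rfl | hne
    · exact isClosedIn_empty _
    unfold IrredIn at hirr
    push Not at hirr
    obtain ⟨S, hS, hlt, hAS⟩ := hirr hA hne
    rw [hAS, Set.sUnion_eq_biUnion]
    exact IsClosedIn.biUnion_finset S _ fun B hB => ih B ⟨hS hB, hA, hlt B hB⟩ (hS hB)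

theorem IrredIn.exists_subset_of_subset_sUnion {X : Type*} {C : Set (Set X)}
    (hC : NoetherianFamily C) {A : Set X} (hA : IrredIn C A) {S : Finset (Set X)}
    (hS : ↑S ⊆ C) (h : A ⊆ ⋃₀ ↑S) : ∃ B ∈ S, A ⊆ B := by
  classical
  by_contra! hcon
  refine hA.2.2 (S.image (A ∩ ·)) ?_ ?_ ?_
  · intro D hD
    obtain ⟨B, hB, rfl⟩ := Finset.mem_image.1 (Finset.mem_coe.1 hD)
    exact hC.2.1 A hA.1 B (hS hB)
  · intro D hD
    obtain ⟨B, hB, rfl⟩ := Finset.mem_image.1 hD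
    exact ⟨Set.inter_subset_left, fun hsub => hcon B hB fun x hx => (hsub hx).2⟩
  · ext x
    constructor
    · intro hx
      obtain ⟨B, hB, hxB⟩ := h hx
      exact ⟨A ∩ B, Finset.mem_coe.2 (Finset.mem_image_of_mem _ hB), hx, hxB⟩
    · rintro ⟨D, hD, hxD⟩
      obtain ⟨B, hB, rfl⟩ := Finset.mem_image.1 (Finset.mem_coe.1 hD)
      exact hxD.1

theorem IrredIn.not_subset_union {X : Type*} {C : Set (Set X)}
    (hC : NoetherianFamily C) {Z A B : Set X} (hZ : IrredIn C Z)
    (hA : IsClosedIn C A) (hB : IsClosedIn C B) (hZA : ¬ Z ⊆ A) (hZB : ¬ Z ⊆ B) :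
    ¬ Z ⊆ A ∪ B := by
  classical
  obtain ⟨S, hS, rfl⟩ := hA
  obtain ⟨T, hT, rfl⟩ := hB
  intro h
  rw [← Set.sUnion_union, ← Finset.coe_union] at h
  obtain ⟨D, hD, hZD⟩ := hZ.exists_subset_of_subset_sUnion hC (by simp [hS, hT]) h
  rcases Finset.mem_union.1 hD with hD | hD
  · exact hZA (hZD.trans (Set.subset_sUnion_of_mem hD))
  · exact hZB (hZD.trans (Set.subset_sUnion_of_mem hD))

/-- A constructible set either contains or misses a nonempty relatively open part of a given
irreducible set. -/
theorem ConstructibleIn.exists_closed_diff {X : Type*} {C : Set (Set X)}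
    (hC : NoetherianFamily C) {Z Y : Set X} (hZ : IrredIn C Z) (hY : ConstructibleIn C Y) :
    ∃ F, IsClosedIn C F ∧ ¬ Z ⊆ F ∧ (Z ⊆ F ∪ Y ∨ Z ⊆ F ∪ Yᶜ) := by
  induction hY with
  | of_closed A hA =>
    by_cases h : Z ⊆ A
    · exact ⟨∅, isClosedIn_empty C, fun h0 => hZ.2.1.ne_empty (Set.subset_empty_iff.1 h0),
        Or.inl (h.trans Set.subset_union_right)⟩
    · exact ⟨A, hA, h, Or.inr (by simp)⟩
  | compl A _ ih =>
    obtain ⟨F, hF, hZF, h⟩ := ih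
    exact ⟨F, hF, hZF, by rwa [compl_compl, or_comm]⟩
  | union A B _ _ ihA ihB =>
    obtain ⟨F, hF, hZF, hA | hA⟩ := ihA
    · exact ⟨F, hF, hZF, Or.inl (hA.trans (Set.union_subset_union_right F Set.subset_union_left))⟩
    obtain ⟨G, hG, hZG, hB | hB⟩ := ihB
    · exact ⟨G, hG, hZG, Or.inl (hB.trans (Set.union_subset_union_right G Set.subset_union_right))⟩
    refine ⟨F ∪ G, hF.union hG, hZ.not_subset_union hC hF hG hZF hZG, Or.inr fun x hx => ?_⟩
    have h1 := hA hx
    have h2 := hB hx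
    simp only [Set.mem_union, Set.mem_compl_iff] at *
    tauto

/-- An irreducible set inside the closure of the boundary of a constructible set `Y` is not an
irreducible component of the closure of `Y`. -/
theorem ConstructibleIn.exists_irred_ssuperset {X : Type*} {C : Set (Set X)}
    (hC : NoetherianFamily C) {Y Z : Set X} (hY : ConstructibleIn C Y) (hZ : IrredIn C Z)
    (h : Z ⊆ closureIn C (closureIn C Y \ Y)) :
    ∃ W, IrredIn C W ∧ W ⊆ closureIn C Y ∧ Z ⊂ W := by
  classical
  by_contra! hmax
  have hcl := hC.isClosedIn_closureIn Y
  have hZY : Z ⊆ closureIn C Y := h.trans (closureIn_subset hcl Set.sdiff_subset)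
  obtain ⟨S, hS, hYS⟩ := hC.exists_irred_decomposition hcl
  have hR : IsClosedIn C (⋃₀ ↑(S.erase Z)) :=
    ⟨S.erase Z, fun B hB => (hS B (Finset.mem_of_mem_erase hB)).1, rfl⟩
  have hZR : ¬ Z ⊆ ⋃₀ ↑(S.erase Z) := by
    intro hsub
    obtain ⟨B, hB, hZB⟩ := hZ.exists_subset_of_subset_sUnion hC
      (fun B hB => (hS B (Finset.mem_of_mem_erase hB)).1) hsub
    obtain ⟨hne, hBS⟩ := Finset.mem_erase.1 hB
    refine hmax B (hS B hBS) ?_ (hZB.ssubset_of_ne hne.symm)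
    rw [hYS]
    exact Set.subset_sUnion_of_mem hBS
  have hcover : closureIn C Y ⊆ Z ∪ ⋃₀ ↑(S.erase Z) := by
    rw [hYS]
    rintro x ⟨B, hB, hxB⟩
    by_cases hBZ : B = Z
    · exact Or.inl (hBZ ▸ hxB)
    · exact Or.inr ⟨B, Finset.mem_coe.2 (Finset.mem_erase.2 ⟨hBZ, hB⟩), hxB⟩
  obtain ⟨F, hF, hZF, hFY⟩ := hY.exists_closed_diff hC hZ
  refine hZ.not_subset_union hC hF hR hZF hZR ?_
  rcases hFY with hFY | hFY
  · refine h.trans (closureIn_subset (hF.union hR) ?_)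
    rintro x ⟨hx, hxY⟩
    rcases hcover hx with hx | hx
    · exact Or.inl ((hFY hx).resolve_right hxY)
    · exact Or.inr hx
  · refine hZY.trans (closureIn_subset (hF.union hR) fun x hxY => ?_)
    rcases hcover (subset_closureIn C Y hxY) with hx | hx
    · exact Or.inl ((hFY hx).resolve_right fun hn => hn hxY)
    · exact Or.inr hx

theorem NoetherianFamily.rirrOrd_lt {X : Type*} {C : Set (Set X)} (hC : NoetherianFamily C)
    {A B : Set X} (hA : IrredIn C A) (hB : IrredIn C B) (h : A ⊂ B) :
    rirrOrd C A < rirrOrd C B := by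
  unfold rirrOrd
  rw [dif_pos hC.wellFounded_irred, dif_pos hC.wellFounded_irred]
  exact Acc.rank_lt_of_rel _ ⟨hA, hB, h⟩

theorem NoetherianFamily.rirrOrd_mono {X : Type*} {C : Set (Set X)} (hC : NoetherianFamily C)
    {A B : Set X} (hA : IrredIn C A) (hB : IrredIn C B) (h : A ⊆ B) :
    rirrOrd C A ≤ rirrOrd C B := by
  rcases h.eq_or_ssubset with rfl | h
  · exact le_rfl
  · exact (hC.rirrOrd_lt hA hB h).le

theorem rirrOrd_le_rirr {X : Type*} {C : Set (Set X)} {Y B : Set X} (hB : IrredIn C B)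
    (h : B ⊆ closureIn C Y) : (rirrOrd C B : WithBot Ordinal) ≤ rirr C Y := by
  unfold rirr
  rw [if_pos ⟨B, hB, h⟩, WithBot.coe_le_coe]
  refine le_csSup ?_ ⟨B, hB, h, rfl⟩
  refine (Ordinal.bddAbove_of_small (s := Set.range (rirrOrd C))).mono ?_
  rintro _ ⟨D, -, -, rfl⟩
  exact ⟨D, rfl⟩

/-- The rank of a set is `⊥` or attained by an irreducible member inside its closure. -/
theorem NoetherianFamily.rirr_eq_bot_or_exists {X : Type*} {C : Set (Set X)}
    (hC : NoetherianFamily C) (Y : Set X) :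
    rirr C Y = ⊥ ∨ ∃ B, IrredIn C B ∧ B ⊆ closureIn C Y ∧ rirr C Y = rirrOrd C B := by
  by_cases hex : ∃ B, IrredIn C B ∧ B ⊆ closureIn C Y
  · right
    obtain ⟨S, hS, hYS⟩ := hC.exists_irred_decomposition (hC.isClosedIn_closureIn Y)
    have hcomp : ∀ D, IrredIn C D → D ⊆ closureIn C Y → ∃ B ∈ S, D ⊆ B := fun D hD hDY =>
      hD.exists_subset_of_subset_sUnion hC (fun B hB => (hS B hB).1) (hYS ▸ hDY)
    obtain ⟨D, hD, hDY⟩ := hex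
    obtain ⟨E, hE, -⟩ := hcomp D hD hDY
    obtain ⟨B, hB, hBmax⟩ := S.exists_max_image (rirrOrd C) ⟨E, hE⟩
    have hBY : B ⊆ closureIn C Y := hYS ▸ Set.subset_sUnion_of_mem hB
    refine ⟨B, hS B hB, hBY, le_antisymm ?_ (rirrOrd_le_rirr (hS B hB) hBY)⟩
    unfold rirr
    rw [if_pos ⟨D, hD, hDY⟩, WithBot.coe_le_coe]
    refine csSup_le ⟨_, D, hD, hDY, rfl⟩ ?_
    rintro _ ⟨G, hG, hGY, rfl⟩
    obtain ⟨H, hH, hGH⟩ := hcomp G hG hGY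
    exact (hC.rirrOrd_mono hG (hS H hH) hGH).trans (hBmax H hH)
  · left
    unfold rirr
    rw [if_neg hex]

theorem NoetherianFamily.bot_lt_rirr {X : Type*} {C : Set (Set X)} (hC : NoetherianFamily C)
    {Y : Set X} (hne : Y.Nonempty) : ⊥ < rirr C Y := by
  obtain ⟨S, hS, hYS⟩ := hC.exists_irred_decomposition (hC.isClosedIn_closureIn Y)
  obtain ⟨y, hy⟩ := hne
  have hyS := subset_closureIn C Y hy
  rw [hYS] at hyS
  obtain ⟨B, hB, -⟩ := hyS
  exact (WithBot.bot_lt_coe _).trans_le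
    (rirrOrd_le_rirr (hS B hB) (hYS ▸ Set.subset_sUnion_of_mem hB))

/-- Let `C` be a Noetherian collection of subsets of `X`. If `Y ⊆ X`
is constructible and nonempty, then `Rirr(closure(Y) \ Y) < Rirr(Y)`. -/
theorem rirr_boundary_lt {X : Type*} (C : Set (Set X))
    (hC : NoetherianFamily C) (Y : Set X)
    (hY : ConstructibleIn C Y) (hne : Y.Nonempty) :
    rirr C (closureIn C Y \ Y) < rirr C Y := by
  rcases hC.rirr_eq_bot_or_exists (closureIn C Y \ Y) with h | ⟨Z, hZ, hsub, h⟩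
  · rw [h]
    exact hC.bot_lt_rirr hne
  · obtain ⟨W, hW, hWY, hZW⟩ := hY.exists_irred_ssuperset hC hZ hsub
    rw [h]
    exact (WithBot.coe_lt_coe.2 (hC.rirrOrd_lt hZ hW hZW)).trans_le (rirrOrd_le_rirr hW hWY)
end

section
/- Let C be a Noetherian collection of subsets of a set X and B the Boolean algebra of subsets of X generated by C. Let U and V be ultrafilters on X with minimal elements D_U and D_V of U ∩ C and V ∩ C respectively. If U and V do not contain the same members of B and D_U ∈ V, then Rirr(D_V) < Rirr(D_U). (That is, the minimal closed set of an ultrafilter isolates its trace on B among all traces of rank at least Rirr(D_U).) -/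
/-- The Boolean algebra of subsets of `X` generated by `C`: all finite Boolean
combinations of members of `C`. -/
inductive BoolGen {X : Type*} (C : Set (Set X)) : Set X → Prop
  | of_mem : ∀ A ∈ C, BoolGen C A
  | compl : ∀ A, BoolGen C A → BoolGen C Aᶜ
  | union : ∀ A B, BoolGen C A → BoolGen C B → BoolGen C (A ∪ B)

/-- `D` is the minimal element of `U ∩ C` with respect to inclusion: a member of `C`
belonging to the ultrafilter `U` such that no member of `C` belonging to `U` is
properly contained in it. -/
def MinClosedOf {X : Type*} (C : Set (Set X)) (U : Ultrafilter X) (D : Set X) : Prop :=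
  D ∈ C ∧ D ∈ U ∧ ∀ A ∈ C, A ∈ U → A ⊆ D → A = D

theorem FamilyDCC.wellFounded_irredIn {X : Type*} {C : Set (Set X)} (hC : FamilyDCC C) :
    WellFounded (fun B B' : Set X => IrredIn C B ∧ IrredIn C B' ∧ B ⊂ B') := by
  rw [wellFounded_iff_isEmpty_descending_chain]
  refine ⟨fun ⟨f, hf⟩ => ?_⟩
  obtain ⟨n, hn⟩ := hC f (fun n => (hf n).2.1.1) (fun n => (hf n).2.2.subset)
  exact (hf n).2.2.ne (hn (n + 1) n.le_succ)

theorem rirrOrd_lt_rirrOrd {X : Type*} {C : Set (Set X)} (hC : FamilyDCC C) {A B : Set X}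
    (hA : IrredIn C A) (hB : IrredIn C B) (hAB : A ⊂ B) : rirrOrd C A < rirrOrd C B := by
  have h := hC.wellFounded_irredIn
  simp only [rirrOrd, dif_pos h]
  exact Acc.rank_lt_of_rel (h.apply B) ⟨hA, hB, hAB⟩

namespace MinClosedOf

variable {X : Type*} {C : Set (Set X)} {U V : Ultrafilter X} {D : Set X}

theorem irredIn (h : MinClosedOf C U D) : IrredIn C D := by
  obtain ⟨hDC, hDU, hmin⟩ := h
  refine ⟨hDC, U.nonempty_of_mem hDU, fun S hSC hS hD => ?_⟩
  rw [hD, Ultrafilter.finite_sUnion_mem_iff S.finite_toSet] at hDU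
  obtain ⟨B, hBS, hBU⟩ := hDU
  exact (hS B hBS).ne (hmin B (hSC hBS) hBU (hS B hBS).subset)

theorem subset_of_mem (hC : ∀ A ∈ C, ∀ B ∈ C, A ∩ B ∈ C) (h : MinClosedOf C U D)
    {A : Set X} (hA : A ∈ C) (hAU : A ∈ U) : D ⊆ A :=
  Set.inter_eq_left.1 <|
    h.2.2 _ (hC D h.1 A hA) (Filter.inter_mem h.2.1 hAU) Set.inter_subset_left

theorem mem_iff_subset (hC : ∀ A ∈ C, ∀ B ∈ C, A ∩ B ∈ C) (h : MinClosedOf C U D)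
    {A : Set X} (hA : A ∈ C) : A ∈ U ↔ D ⊆ A :=
  ⟨h.subset_of_mem hC hA, Filter.mem_of_superset h.2.1⟩

/-- The minimal element of an ultrafilter determines its trace on the Boolean algebra
generated by `C`. -/
theorem mem_iff_mem (hC : ∀ A ∈ C, ∀ B ∈ C, A ∩ B ∈ C) (hU : MinClosedOf C U D)
    (hV : MinClosedOf C V D) {A : Set X} (hA : BoolGen C A) : A ∈ U ↔ A ∈ V := by
  induction hA with
  | of_mem A hA => rw [hU.mem_iff_subset hC hA, hV.mem_iff_subset hC hA]
  | compl A _ ih => rw [Ultrafilter.compl_mem_iff_notMem, Ultrafilter.compl_mem_iff_notMem, ih]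
  | union A B _ _ ihA ihB => rw [Ultrafilter.union_mem_iff, Ultrafilter.union_mem_iff, ihA, ihB]

end MinClosedOf

/-- Let `C` be a Noetherian collection of subsets of `X`, and let
`U, V` be ultrafilters on `X` with minimal elements `D_U` and `D_V`. If `U` and `V` do
not contain the same members of the Boolean algebra generated by `C` and `D_U ∈ V`,
then `Rirr(D_V) < Rirr(D_U)`. -/
theorem minClosed_isolates {X : Type*} (C : Set (Set X)) (hC : NoetherianFamily C)
    (U V : Ultrafilter X) (DU DV : Set X)
    (hU : MinClosedOf C U DU) (hV : MinClosedOf C V DV)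
    (hdiff : ¬ ∀ A : Set X, BoolGen C A → (A ∈ U ↔ A ∈ V))
    (hDU : DU ∈ V) :
    rirrOrd C DV < rirrOrd C DU := by
  obtain ⟨-, hinter, hdcc⟩ := hC
  refine rirrOrd_lt_rirrOrd hdcc hV.irredIn hU.irredIn
    ((hV.subset_of_mem hinter hU.1 hDU).ssubset_of_ne ?_)
  rintro rfl
  exact hdiff fun _ hA => hU.mem_iff_mem hinter hV hA
end
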